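/- (John–Nirenberg inequality.) There exist constants C₁, C₂ > 0 depending only on the dimension d with the following property: for every cube Q₀ ⊂ ℝ^d and every w ∈ L¹(Q₀) whose BMO seminorm |w|_BMO := sup{ (1/|Q|)∫_Q |w − w_Q| : Q a subcube of Q₀ } is finite and nonzero, every subcube Q ⊆ Q₀, and every λ > 0, one has |{ x ∈ Q : |w(x) − w_Q| > λ }| ≤ C₁ |Q| exp( − C₂ λ / |w|_BMO ). -/

import Mathlib

open MeasureTheory ENNReal

/-- An axis-parallel (closed) cube in `ℝ^d` with positive side length. -/
def IsCube {d : ℕ} (Q : Set (Fin d → ℝ)) : Prop :=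
  ∃ (a : Fin d → ℝ) (l : ℝ), 0 < l ∧ Q = Set.univ.pi fun i => Set.Icc (a i) (a i + l)

/-- The set of mean oscillations of `w` over axis-parallel subcubes of `Q₀`. -/
noncomputable def oscSet {d : ℕ} (w : (Fin d → ℝ) → ℝ) (Q₀ : Set (Fin d → ℝ)) : Set ℝ :=
  {a : ℝ | ∃ Q : Set (Fin d → ℝ), IsCube Q ∧ Q ⊆ Q₀ ∧
    a = ⨍ z in Q, |w z - ⨍ y in Q, w y|}

/-- The `BMO` seminorm of `w` over the cube `Q₀`:
`|w|_BMO = sup { ⨍_Q |w − w_Q| : Q an axis-parallel subcube of Q₀ }`. -/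
noncomputable def bmoSeminorm {d : ℕ} (w : (Fin d → ℝ) → ℝ) (Q₀ : Set (Fin d → ℝ)) : ℝ :=
  sSup (oscSet w Q₀)

namespace JohnNirenberg

open Set Filter Topology

variable {d : ℕ}

/-- The closed cube with lower corner `P.1` and side length `P.2`. -/
def cube (P : (Fin d → ℝ) × ℝ) : Set (Fin d → ℝ) :=
  univ.pi fun i => Icc (P.1 i) (P.1 i + P.2)

/-- `P` is the corner and side length of a nondegenerate subcube of the cube encoded by `Q`. -/
def IsSubcube (P Q : (Fin d → ℝ) × ℝ) : Prop :=
  0 < P.2 ∧ P.2 ≤ Q.2 ∧ ∀ i, Q.1 i ≤ P.1 i ∧ P.1 i + P.2 ≤ Q.1 i + Q.2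

lemma mem_cube {P : (Fin d → ℝ) × ℝ} {x : Fin d → ℝ} :
    x ∈ cube P ↔ ∀ i, P.1 i ≤ x i ∧ x i ≤ P.1 i + P.2 := by
  simp only [cube, mem_univ_pi, mem_Icc]

lemma IsSubcube.refl {Q : (Fin d → ℝ) × ℝ} (hQ : 0 < Q.2) : IsSubcube Q Q :=
  ⟨hQ, le_rfl, fun _ => ⟨le_rfl, le_rfl⟩⟩

lemma IsSubcube.subset {P Q : (Fin d → ℝ) × ℝ} (h : IsSubcube P Q) : cube P ⊆ cube Q := by
  intro x hx
  rw [mem_cube] at hx ⊢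
  intro i
  have := hx i
  have := h.2.2 i
  constructor <;> linarith

lemma cube_eq_closedBall (P : (Fin d → ℝ) × ℝ) (h : 0 ≤ P.2) :
    cube P = Metric.closedBall (fun i => P.1 i + P.2 / 2) (P.2 / 2) := by
  rw [closedBall_pi _ (by positivity)]
  simp only [cube, Real.closedBall_eq_Icc]
  congr! 3 <;> ring

lemma measurableSet_cube (P : (Fin d → ℝ) × ℝ) : MeasurableSet (cube P) :=
  MeasurableSet.univ_pi fun _ => measurableSet_Icc

lemma isCube_cube {P : (Fin d → ℝ) × ℝ} (h : 0 < P.2) : IsCube (cube P) :=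
  ⟨P.1, P.2, h, rfl⟩

lemma volume_cube (P : (Fin d → ℝ) × ℝ) : volume (cube P) = ENNReal.ofReal P.2 ^ d := by
  simp only [cube, volume_pi_pi, Real.volume_Icc, add_sub_cancel_left, Finset.prod_const,
    Finset.card_univ, Fintype.card_fin]

lemma volume_cube_ne_zero {P : (Fin d → ℝ) × ℝ} (h : 0 < P.2) : volume (cube P) ≠ 0 := by
  rw [volume_cube]
  exact pow_ne_zero _ (by simpa using h)

lemma volume_cube_ne_top (P : (Fin d → ℝ) × ℝ) : volume (cube P) ≠ ⊤ := by
  rw [volume_cube]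
  exact ENNReal.pow_ne_top ENNReal.ofReal_ne_top

lemma nonempty_interior_cube {P : (Fin d → ℝ) × ℝ} (h : 0 < P.2) :
    (interior (cube P)).Nonempty := by
  rw [cube_eq_closedBall P h.le]
  exact ⟨_, Metric.ball_subset_interior_closedBall (Metric.mem_ball_self (half_pos h))⟩

/-- A fivefold enlargement of a subcube which stays a subcube of the big cube. -/
lemma exists_enlargement {P Q : (Fin d → ℝ) × ℝ} (h : IsSubcube P Q) :
    ∃ P', IsSubcube P' Q ∧ P'.2 ≤ 5 * P.2 ∧ cube P ⊆ cube P' ∧ (P' = Q ∨ 2 * P.2 ≤ P'.2) ∧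
      ∀ R, IsSubcube R Q → R.2 ≤ 2 * P.2 → (cube R ∩ cube P).Nonempty → cube R ⊆ cube P' := by
  obtain ⟨hP, hPQ, hc⟩ := h
  rcases le_total (5 * P.2) Q.2 with h5 | h5
  · have key : ∀ i, ∃ c, Q.1 i ≤ c ∧ c + 5 * P.2 ≤ Q.1 i + Q.2 ∧
        (c ≤ Q.1 i ∨ c ≤ P.1 i - 2 * P.2) ∧
        (Q.1 i + Q.2 ≤ c + 5 * P.2 ∨ P.1 i + 3 * P.2 ≤ c + 5 * P.2) := by
      intro i
      have := hc i
      rcases le_total (P.1 i - 2 * P.2) (Q.1 i) with h1 | h1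
      · exact ⟨Q.1 i, le_rfl, by linarith, Or.inl le_rfl, Or.inr (by linarith)⟩
      · rcases le_total (P.1 i + 3 * P.2) (Q.1 i + Q.2) with h2 | h2
        · exact ⟨P.1 i - 2 * P.2, by linarith, by linarith, Or.inr le_rfl, Or.inr (by linarith)⟩
        · exact ⟨Q.1 i + Q.2 - 5 * P.2, by linarith, by linarith, Or.inr (by linarith),
            Or.inl (by linarith)⟩
    choose c h1 h2 h3 h4 using key
    refine ⟨(c, 5 * P.2), ⟨by simpa using hP, h5, fun i => ⟨h1 i, h2 i⟩⟩, le_rfl, ?_,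
      Or.inr (by dsimp only; linarith), ?_⟩
    · intro x hx
      rw [mem_cube] at hx ⊢
      intro i
      have := hx i
      have := hc i
      dsimp only
      constructor
      · rcases h3 i with h | h <;> linarith
      · rcases h4 i with h | h <;> linarith
    · rintro R ⟨hR, hRQ, hRc⟩ hRP ⟨y, hyR, hyP⟩ x hx
      rw [mem_cube] at hx hyR hyP ⊢
      intro i
      have := hx i
      have := hc i
      have := hRc i
      have := hyR i
      have := hyP i
      dsimp only
      constructor
      · rcases h3 i with h | h <;> linarith
      · rcases h4 i with h | h <;> linarith
  · exact ⟨Q, .refl (hP.trans_le hPQ), h5, IsSubcube.subset ⟨hP, hPQ, hc⟩, Or.inl rfl,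
      fun R hR _ _ => hR.subset⟩

/-- Lebesgue differentiation along subcubes of a fixed cube. -/
lemma ae_exists_lt_average {Q : (Fin d → ℝ) × ℝ} (hQ : 0 < Q.2) {g : (Fin d → ℝ) → ℝ}
    (hg : IntegrableOn g (cube Q)) (α : ℝ) :
    ∀ᵐ x, x ∈ cube Q → α < g x →
      ∃ P, IsSubcube P Q ∧ x ∈ cube P ∧ α < ⨍ y in cube P, g y := by
  have hint : LocallyIntegrable ((cube Q).indicator g) volume :=
    (hg.integrable_indicator (measurableSet_cube Q)).locallyIntegrable
  filter_upwards [IsUnifLocDoublingMeasure.ae_tendsto_average volume hint 1] with x hx hxQ hxα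
  let P : ℝ → (Fin d → ℝ) × ℝ := fun t => (fun i => x i - t * (x i - Q.1 i), t * Q.2)
  have hxQ' := mem_cube.1 hxQ
  have hev : ∀ᶠ t in 𝓝[>] (0 : ℝ), 0 < t ∧ t ≤ 1 := by
    filter_upwards [Ioc_mem_nhdsGT (zero_lt_one' ℝ)] with t ht using ht
  have hP : ∀ t, 0 < t ∧ t ≤ 1 → IsSubcube (P t) Q ∧ x ∈ cube (P t) := by
    rintro t ⟨h0, h1⟩
    refine ⟨⟨by simp only [P]; positivity, by simp only [P]; nlinarith, fun i => ?_⟩,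
      mem_cube.2 fun i => ?_⟩
    all_goals
      have := hxQ' i
      simp only [P]
      constructor <;> nlinarith
  have hlim := @hx ℝ (𝓝[>] 0) (fun t i => (P t).1 i + (P t).2 / 2) (fun t => (P t).2 / 2)
    (by
      refine tendsto_nhdsWithin_iff.2 ⟨?_, ?_⟩
      · have : Tendsto (fun t : ℝ => t * Q.2 / 2) (𝓝 0) (𝓝 (0 * Q.2 / 2)) :=
          Continuous.tendsto (by fun_prop) 0
        simpa using this.mono_left nhdsWithin_le_nhds
      · filter_upwards [hev] with t ht using half_pos (hP t ht).1.1)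
    (by
      filter_upwards [hev] with t ht
      rw [one_mul, ← cube_eq_closedBall _ (hP t ht).1.1.le]
      exact (hP t ht).2)
  rw [indicator_of_mem hxQ] at hlim
  obtain ⟨t, ht, htα⟩ := (hev.and (hlim.eventually (lt_mem_nhds hxα))).exists
  refine ⟨P t, (hP t ht).1, (hP t ht).2, ?_⟩
  rw [← cube_eq_closedBall _ (hP t ht).1.1.le] at htα
  rwa [setAverage_congr_fun (measurableSet_cube _)
    (ae_of_all _ fun y hy => indicator_of_mem ((hP t ht).1.subset hy) g)] at htα

/-- A Calderón–Zygmund type covering of a superlevel set by subcubes of a given cube. -/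
lemma exists_covering {Q : (Fin d → ℝ) × ℝ} (hQ : 0 < Q.2) {g : (Fin d → ℝ) → ℝ}
    (hg : IntegrableOn g (cube Q)) (hg0 : ∀ x, 0 ≤ g x) {α : ℝ}
    (hα : ⨍ y in cube Q, g y ≤ α) :
    ∃ (u : Set ((Fin d → ℝ) × ℝ)) (E : (Fin d → ℝ) × ℝ → (Fin d → ℝ) × ℝ), u.Countable ∧
      (∀ P ∈ u, IsSubcube (E P) Q ∧ ⨍ y in cube (E P), g y ≤ α) ∧
      (∀ᵐ x, x ∈ cube Q → α < g x → ∃ P ∈ u, x ∈ cube (E P)) ∧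
      ENNReal.ofReal α * ∑' P : u, volume (cube (E P)) ≤
        5 ^ d * ∫⁻ x in cube Q, ENNReal.ofReal (g x) := by
  let T : Set ((Fin d → ℝ) × ℝ) := {P | IsSubcube P Q ∧ α ≤ ⨍ y in cube P, g y ∧
    ∀ P', IsSubcube P' Q → cube P ⊆ cube P' → 2 * P.2 ≤ P'.2 → ⨍ y in cube P', g y < α}
  have hsel : ∀ P, ∃ P', P ∈ T → IsSubcube P' Q ∧ P'.2 ≤ 5 * P.2 ∧ cube P ⊆ cube P' ∧
      (P' = Q ∨ 2 * P.2 ≤ P'.2) ∧ ∀ R, IsSubcube R Q → R.2 ≤ 2 * P.2 →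
        (cube R ∩ cube P).Nonempty → cube R ⊆ cube P' := by
    intro P
    by_cases hP : P ∈ T
    · obtain ⟨P', h⟩ := exists_enlargement hP.1
      exact ⟨P', fun _ => h⟩
    · exact ⟨P, fun h => absurd h hP⟩
  choose E hE using hsel
  obtain ⟨u, huT, hdisj, hcov⟩ := Vitali.exists_disjoint_subfamily_covering_enlargement cube T
    (fun P => P.2) 2 one_lt_two (fun P hP => hP.1.1.le) Q.2 (fun P hP => hP.1.2.1)
    (fun P hP => (nonempty_interior_cube hP.1.1).mono interior_subset)
  have hu : u.Countable := hdisj.countable_of_nonempty_interior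
    fun P hP => nonempty_interior_cube (huT hP).1.1
  refine ⟨u, E, hu, fun P hP => ⟨(hE P (huT hP)).1, ?_⟩, ?_, ?_⟩
  · obtain ⟨h1, -, h3, h4, -⟩ := hE P (huT hP)
    rcases h4 with h4 | h4
    · rwa [h4]
    · exact ((huT hP).2.2 _ h1 h3 h4).le
  · filter_upwards [ae_exists_lt_average hQ hg α] with x hx hxQ hxα
    obtain ⟨P₀, hP₀, hxP₀, hP₀α⟩ := hx hxQ hxα
    set S : Set ℝ := {s | ∃ P, IsSubcube P Q ∧ x ∈ cube P ∧ α ≤ ⨍ y in cube P, g y ∧ P.2 = s}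
    have hSbdd : BddAbove S := ⟨Q.2, by rintro s ⟨P, hP, -, -, rfl⟩; exact hP.2.1⟩
    have hS₀ : P₀.2 ∈ S := ⟨P₀, hP₀, hxP₀, hP₀α.le, rfl⟩
    have hpos : 0 < sSup S := hP₀.1.trans_le (le_csSup hSbdd hS₀)
    obtain ⟨_, ⟨P, hP, hxP, hPα, rfl⟩, hlt⟩ := exists_lt_of_lt_csSup ⟨_, hS₀⟩ (half_lt_self hpos)
    have hPT : P ∈ T := by
      refine ⟨hP, hPα, fun P' hP' hsub h2 => ?_⟩
      by_contra! hcon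
      have := le_csSup hSbdd (⟨P', hP', hsub hxP, hcon, rfl⟩ : P'.2 ∈ S)
      linarith
    obtain ⟨R, hR, hne, hside⟩ := hcov P hPT
    exact ⟨R, hR, (hE R (huT hR)).2.2.2.2 P hP hside hne hxP⟩
  · have hstep : ∀ P : u, ENNReal.ofReal α * volume (cube (E P)) ≤
        5 ^ d * ∫⁻ x in cube (P : (Fin d → ℝ) × ℝ), ENNReal.ofReal (g x) := by
      rintro ⟨P, hP⟩
      have hPT := huT hP
      have hvol : volume (cube (E P)) ≤ 5 ^ d * volume (cube P) := by
        rw [volume_cube, volume_cube, ← mul_pow]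
        gcongr
        calc ENNReal.ofReal (E P).2 ≤ ENNReal.ofReal (5 * P.2) :=
              ENNReal.ofReal_le_ofReal (hE P hPT).2.1
          _ = 5 * ENNReal.ofReal P.2 := by
              rw [ENNReal.ofReal_mul (by norm_num)]; norm_num
      have hgP : IntegrableOn g (cube P) := hg.mono_set hPT.1.subset
      have havg : ENNReal.ofReal α * volume (cube P) ≤
          ∫⁻ x in cube P, ENNReal.ofReal (g x) := by
        have h0 : 0 < volume.real (cube P) :=
          ENNReal.toReal_pos (volume_cube_ne_zero hPT.1.1) (volume_cube_ne_top P)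
        have h1 := hPT.2.1
        rw [setAverage_eq, smul_eq_mul, inv_mul_eq_div, le_div_iff₀ h0] at h1
        rw [← ofReal_integral_eq_lintegral_ofReal hgP (ae_of_all _ hg0),
          ← ofReal_measureReal (volume_cube_ne_top P), ← ENNReal.ofReal_mul' h0.le]
        exact ENNReal.ofReal_le_ofReal h1
      calc ENNReal.ofReal α * volume (cube (E P))
          ≤ ENNReal.ofReal α * (5 ^ d * volume (cube P)) := by gcongr
        _ = 5 ^ d * (ENNReal.ofReal α * volume (cube P)) := by ring
        _ ≤ _ := by gcongr
    rw [← ENNReal.tsum_mul_left]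
    refine (ENNReal.tsum_le_tsum hstep).trans ?_
    rw [ENNReal.tsum_mul_left, ← lintegral_biUnion hu (fun P _ => measurableSet_cube P) hdisj]
    gcongr
    exact iUnion₂_subset fun P hP => (huT hP).1.subset

lemma abs_average_sub_le {P : (Fin d → ℝ) × ℝ} (hP : 0 < P.2) {w : (Fin d → ℝ) → ℝ}
    (hw : IntegrableOn w (cube P)) (c : ℝ) :
    |(⨍ y in cube P, w y) - c| ≤ ⨍ y in cube P, |w y - c| := by
  have h0 : 0 < volume.real (cube P) :=
    ENNReal.toReal_pos (volume_cube_ne_zero hP) (volume_cube_ne_top P)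
  have hc : IntegrableOn (fun _ => c) (cube P) :=
    integrableOn_const (volume_cube_ne_top P)
  have h1 : (⨍ y in cube P, w y) - c = ⨍ y in cube P, (w y - c) := by
    rw [setAverage_eq, setAverage_eq, integral_sub hw hc, setIntegral_const]
    simp only [smul_eq_mul]
    field_simp
  rw [h1, setAverage_eq, setAverage_eq, smul_eq_mul, smul_eq_mul, abs_mul,
    abs_of_pos (inv_pos.2 h0)]
  gcongr
  exact abs_integral_le_integral_abs

/-- The iterated form of the John–Nirenberg inequality. -/
lemma volume_lt_abs_sub_average_le {Q₀ : Set (Fin d → ℝ)} {w : (Fin d → ℝ) → ℝ}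
    (hw : IntegrableOn w Q₀) {B : ℝ} (hB : 0 < B)
    (hosc : ∀ P : (Fin d → ℝ) × ℝ, 0 < P.2 → cube P ⊆ Q₀ →
      ⨍ z in cube P, |w z - ⨍ y in cube P, w y| ≤ B) (n : ℕ) :
    ∀ Q : (Fin d → ℝ) × ℝ, 0 < Q.2 → cube Q ⊆ Q₀ →
      volume {x ∈ cube Q | n * (2 * 5 ^ d * B) < |w x - ⨍ y in cube Q, w y|} ≤
        2⁻¹ ^ n * volume (cube Q) := by
  induction n with
  | zero => exact fun Q _ _ => by simpa using measure_mono (sep_subset _ _)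
  | succ n ih =>
    intro Q hQ hQQ₀
    set α : ℝ := 2 * 5 ^ d * B with hα
    have hBα : B ≤ α := by
      have : (1 : ℝ) ≤ 5 ^ d := one_le_pow₀ (by norm_num)
      nlinarith
    set c := ⨍ y in cube Q, w y
    have hwQ : IntegrableOn w (cube Q) := hw.mono_set hQQ₀
    have hg : IntegrableOn (fun x => |w x - c|) (cube Q) :=
      (hwQ.sub (integrableOn_const (volume_cube_ne_top Q))).abs
    obtain ⟨u, E, hu, hE, hcov, hsum⟩ := exists_covering hQ hg (fun x => abs_nonneg _)
      ((hosc Q hQ hQQ₀).trans hBα)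
    have h0 : 0 < volume.real (cube Q) :=
      ENNReal.toReal_pos (volume_cube_ne_zero hQ) (volume_cube_ne_top Q)
    have hint : ∫⁻ x in cube Q, ENNReal.ofReal |w x - c| ≤
        ENNReal.ofReal B * volume (cube Q) := by
      have h1 := hosc Q hQ hQQ₀
      rw [setAverage_eq, smul_eq_mul, inv_mul_eq_div, div_le_iff₀ h0] at h1
      rw [← ofReal_integral_eq_lintegral_ofReal hg (ae_of_all _ fun x => abs_nonneg _),
        ← ofReal_measureReal (volume_cube_ne_top Q), ← ENNReal.ofReal_mul' h0.le]
      exact ENNReal.ofReal_le_ofReal h1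
    have hhalf : ∑' P : u, volume (cube (E P)) ≤ 2⁻¹ * volume (cube Q) := by
      have h1 := hsum.trans (mul_le_mul_right hint (5 ^ d))
      have hofα : ENNReal.ofReal α = 5 ^ d * ENNReal.ofReal B * 2 := by
        rw [hα, ENNReal.ofReal_mul (by positivity), ENNReal.ofReal_mul (by positivity),
          ENNReal.ofReal_pow (by norm_num)]
        norm_num
        ring
      rw [hofα, ← mul_assoc, mul_assoc _ 2,
        ENNReal.mul_le_mul_iff_right (by simpa using hB) (by finiteness)] at h1
      rw [← ENNReal.div_eq_inv_mul, ENNReal.le_div_iff_mul_le (by simp) (by simp), mul_comm]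
      exact h1
    have hsub : volume {x ∈ cube Q | (n + 1 : ℕ) * α < |w x - c|} ≤
        volume (⋃ P ∈ u, {x ∈ cube (E P) | n * α < |w x - ⨍ y in cube (E P), w y|}) := by
      refine measure_mono_ae ?_
      filter_upwards [hcov] with x hx hxmem
      obtain ⟨hxQ, hxα⟩ := hxmem
      push_cast at hxα
      have hnα : 0 ≤ n * α := mul_nonneg n.cast_nonneg (hB.le.trans hBα)
      obtain ⟨P, hP, hxP⟩ := hx hxQ (by linarith)
      obtain ⟨hPQ, hPα⟩ := hE P hP
      refine mem_iUnion₂.2 ⟨P, hP, hxP, ?_⟩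
      have h1 := (abs_average_sub_le hPQ.1 (hwQ.mono_set hPQ.subset) c).trans hPα
      have h2 := abs_sub_le (w x) (⨍ y in cube (E P), w y) c
      linarith
    calc _ ≤ _ := hsub
      _ ≤ ∑' P : u, volume {x ∈ cube (E P) | n * α < |w x - ⨍ y in cube (E P), w y|} :=
          measure_biUnion_le _ hu _
      _ ≤ ∑' P : u, 2⁻¹ ^ n * volume (cube (E P)) :=
          ENNReal.tsum_le_tsum fun P =>
            ih _ (hE P P.2).1.1 ((hE P P.2).1.subset.trans hQQ₀)
      _ = 2⁻¹ ^ n * ∑' P : u, volume (cube (E P)) := ENNReal.tsum_mul_left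
      _ ≤ 2⁻¹ ^ n * (2⁻¹ * volume (cube Q)) := by gcongr
      _ = _ := by rw [pow_succ, mul_assoc]

lemma inv_two_pow_floor_le (t : ℝ) :
    (2⁻¹ : ℝ≥0∞) ^ ⌊t⌋₊ ≤ ENNReal.ofReal 2 * ENNReal.ofReal (Real.exp (-(Real.log 2 * t))) := by
  have h : (2⁻¹ : ℝ≥0∞) = ENNReal.ofReal (Real.exp (-Real.log 2)) := by
    rw [Real.exp_neg, Real.exp_log two_pos, ENNReal.ofReal_inv_of_pos two_pos]
    norm_num
  rw [h, ← ENNReal.ofReal_pow (Real.exp_pos _).le, ← ENNReal.ofReal_mul two_pos.le,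
    ← Real.exp_nat_mul]
  refine ENNReal.ofReal_le_ofReal ?_
  nth_rewrite 2 [← Real.exp_log two_pos]
  rw [← Real.exp_add, Real.exp_le_exp]
  nlinarith [Nat.lt_floor_add_one t, Real.log_pos one_lt_two]

end JohnNirenberg

/-- **John–Nirenberg inequality.** There are constants `C₁, C₂ > 0`, depending only on the
dimension `d`, such that for every cube `Q₀ ⊂ ℝ^d`, every `w ∈ L¹(Q₀)` with finite nonzero
`BMO` seminorm, every subcube `Q ⊆ Q₀` and every `λ > 0`,
`|{x ∈ Q : |w(x) − w_Q| > λ}| ≤ C₁ |Q| exp(−C₂ λ / |w|_BMO)`. -/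
theorem john_nirenberg (d : ℕ) :
    ∃ C₁ C₂ : ℝ, 0 < C₁ ∧ 0 < C₂ ∧
      ∀ Q₀ : Set (Fin d → ℝ), IsCube Q₀ →
      ∀ w : (Fin d → ℝ) → ℝ, IntegrableOn w Q₀ volume →
        BddAbove (oscSet w Q₀) → bmoSeminorm w Q₀ ≠ 0 →
      ∀ Q : Set (Fin d → ℝ), IsCube Q → Q ⊆ Q₀ →
      ∀ lam : ℝ, 0 < lam →
        volume {x ∈ Q | lam < |w x - ⨍ y in Q, w y|}
          ≤ ENNReal.ofReal C₁ * volume Q *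
            ENNReal.ofReal (Real.exp (-(C₂ * lam) / bmoSeminorm w Q₀)) := by
  refine ⟨2, Real.log 2 / (2 * 5 ^ d), two_pos, div_pos (Real.log_pos one_lt_two) (by positivity),
    ?_⟩
  rintro Q₀ - w hw hbdd hne Q ⟨a, l, hl, rfl⟩ hQQ₀ lam hlam
  have hosc : ∀ P : (Fin d → ℝ) × ℝ, 0 < P.2 → JohnNirenberg.cube P ⊆ Q₀ →
      ⨍ z in JohnNirenberg.cube P, |w z - ⨍ y in JohnNirenberg.cube P, w y| ≤
        bmoSeminorm w Q₀ := fun P hP hPQ₀ =>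
    le_csSup hbdd ⟨_, JohnNirenberg.isCube_cube hP, hPQ₀, rfl⟩
  have hB : 0 < bmoSeminorm w Q₀ := by
    refine lt_of_le_of_ne ?_ hne.symm
    refine le_trans ?_ (hosc (a, l) hl hQQ₀)
    rw [setAverage_eq]
    exact smul_nonneg (by positivity) (integral_nonneg fun x => abs_nonneg _)
  set B := bmoSeminorm w Q₀
  have hα : 0 < 2 * 5 ^ d * B := by positivity
  set t := lam / (2 * 5 ^ d * B) with ht
  have ht0 : 0 ≤ t := by positivity
  have hfloor : ⌊t⌋₊ * (2 * 5 ^ d * B) ≤ lam := by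
    rw [← le_div_iff₀ hα]
    exact Nat.floor_le ht0
  have hexp : -(Real.log 2 / (2 * 5 ^ d) * lam) / B = -(Real.log 2 * t) := by
    rw [ht]
    field_simp
  have hsub : {x ∈ JohnNirenberg.cube (a, l) | lam < |w x - ⨍ y in JohnNirenberg.cube (a, l), w y|}
      ⊆ {x ∈ JohnNirenberg.cube (a, l) |
        ⌊t⌋₊ * (2 * 5 ^ d * B) < |w x - ⨍ y in JohnNirenberg.cube (a, l), w y|} :=
    fun x hx => ⟨hx.1, hfloor.trans_lt hx.2⟩
  calc _ ≤ _ := measure_mono hsub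
    _ ≤ _ := JohnNirenberg.volume_lt_abs_sub_average_le hw hB hosc ⌊t⌋₊ (a, l) hl hQQ₀
    _ ≤ _ := by
      rw [hexp, mul_right_comm]
      exact mul_le_mul_left (JohnNirenberg.inv_two_pow_floor_le t) _
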